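/- Let v₁, v₂ be consistently oriented, ultraparallel, unit spacelike vectors in ℝ³. Suppose pᵢ = aᵢvᵢ⁻ − bᵢvᵢ⁺ with aᵢ, bᵢ > 0 for i = 1, 2. Then the crooked planes C(v₁,p₁) and C(v₂,p₂) are disjoint. -/

import Mathlib

open Matrix

noncomputable section

/-- Minkowski space: ℝ³. -/
abbrev V3 : Type := Fin 3 → ℝ

/-- The Lorentzian inner product `x·y = x₁y₁ + x₂y₂ − x₃y₃`. -/
def mdot (x y : V3) : ℝ := x 0 * y 0 + x 1 * y 1 - x 2 * y 2

/-- The Lorentzian cross product: the unique bilinear map with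
`mdot u (lcross v w) = det [u v w]` (columns `u`, `v`, `w`). -/
def lcross (v w : V3) : V3 :=
  ![v 1 * w 2 - v 2 * w 1, v 2 * w 0 - v 0 * w 2, -(v 0 * w 1 - v 1 * w 0)]

/-- For a spacelike vector `v`, the future-pointing null vector `v⁺` of Euclidean
length 1 which is Lorentz-orthogonal to `v`, where `v⁻, v⁺` are ordered so that
`det[v⁻ v⁺ v] > 0`. -/
def nullPlus (v : V3) : V3 :=
  (1 / (Real.sqrt 2 * (v 0 ^ 2 + v 1 ^ 2))) •
    ![v 0 * v 2 + v 1 * Real.sqrt (mdot v v),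
      v 1 * v 2 - v 0 * Real.sqrt (mdot v v),
      v 0 ^ 2 + v 1 ^ 2]

/-- For a spacelike vector `v`, the future-pointing null vector `v⁻` of Euclidean
length 1 which is Lorentz-orthogonal to `v`, where `v⁻, v⁺` are ordered so that
`det[v⁻ v⁺ v] > 0`. -/
def nullMinus (v : V3) : V3 :=
  (1 / (Real.sqrt 2 * (v 0 ^ 2 + v 1 ^ 2))) •
    ![v 0 * v 2 - v 1 * Real.sqrt (mdot v v),
      v 1 * v 2 + v 0 * Real.sqrt (mdot v v),
      v 0 ^ 2 + v 1 ^ 2]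

/-- `P(x)`: for a future-pointing null vector `x`, the set of spacelike vectors `w`
with `w·x = 0` such that `(w/√(w·w))⁺` is a positive scalar multiple of `x`. -/
def wingSet (x : V3) : Set V3 :=
  {w | 0 < mdot w w ∧ mdot w x = 0 ∧
    ∃ t : ℝ, 0 < t ∧ nullPlus ((Real.sqrt (mdot w w))⁻¹ • w) = t • x}

/-- The crooked plane `C(v,p)`: union of the stem `p + {x | x·v = 0, x·x ≤ 0}`
and the wings `p + P(v⁺)` and `p + P(v⁻)`. -/
def crookedPlane (v p : V3) : Set V3 :=
  {q | mdot (q - p) v = 0 ∧ mdot (q - p) (q - p) ≤ 0} ∪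
  {q | q - p ∈ wingSet (nullPlus v)} ∪
  {q | q - p ∈ wingSet (nullMinus v)}

/-- The crooked half-space `H(v,p)`. -/
def crookedHalf (v p : V3) : Set V3 :=
  {q | (0 ≤ mdot (q - p) v → mdot (q - p) (nullPlus v) ≤ 0) ∧
       (mdot (q - p) v ≤ 0 → 0 ≤ mdot (q - p) (nullMinus v))}

/-- Spacelike vectors `u`, `v` are consistently oriented. -/
def consistentlyOriented (u v : V3) : Prop :=
  mdot u v < 0 ∧ mdot u (nullPlus v) ≤ 0 ∧ mdot u (nullMinus v) ≤ 0 ∧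
  mdot v (nullPlus u) ≤ 0 ∧ mdot v (nullMinus u) ≤ 0

/-- `g` is a linear isometry of the Lorentzian inner product. -/
def isLorentz (g : Matrix (Fin 3) (Fin 3) ℝ) : Prop :=
  ∀ x y : V3, mdot (g.mulVec x) (g.mulVec y) = mdot x y

/-- Membership in `SO(2,1)⁰`, the identity component of the group of linear
isometries of `mdot`: Lorentzian, determinant one, and orthochronous. -/
def inSO21p (g : Matrix (Fin 3) (Fin 3) ℝ) : Prop :=
  isLorentz g ∧ g.det = 1 ∧ 0 < g.mulVec ![0, 0, 1] 2

/-- `g` is hyperbolic: it has three distinct real eigenvalues. -/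
def isHyperbolic (g : Matrix (Fin 3) (Fin 3) ℝ) : Prop :=
  ∃ a b c : ℝ, a ≠ b ∧ a ≠ c ∧ b ≠ c ∧
    g.charpoly = (Polynomial.X - Polynomial.C a) * (Polynomial.X - Polynomial.C b) *
      (Polynomial.X - Polynomial.C c)

/-- `g ≠ I` is parabolic: `1` is its only eigenvalue. -/
def isParabolic (g : Matrix (Fin 3) (Fin 3) ℝ) : Prop :=
  g ≠ 1 ∧ g.charpoly = (Polynomial.X - Polynomial.C 1) ^ 3

/-- `v` is a positive fixed vector of `g`: `gv = v`, `v ≠ 0`, and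
`det[v x gx] > 0` for some null or timelike `x` which is not an eigenvector. -/
def positiveFixed (g : Matrix (Fin 3) (Fin 3) ℝ) (v : V3) : Prop :=
  v ≠ 0 ∧ g.mulVec v = v ∧
  ∃ x : V3, mdot x x ≤ 0 ∧ (∀ t : ℝ, g.mulVec x ≠ t • x) ∧
    0 < mdot v (lcross x (g.mulVec x))

/-- A subgroup of homeomorphisms (here: permutations) of ℝ³ acts properly
discontinuously: for every compact `K`, only finitely many elements move `K`
to meet `K`. -/
def properlyDisc (Γ : Subgroup (Equiv.Perm V3)) : Prop :=
  ∀ K : Set V3, IsCompact K →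
    {f : Equiv.Perm V3 | f ∈ Γ ∧ ((f : V3 → V3) '' K ∩ K).Nonempty}.Finite

/-- The action of `Γ` on ℝ³ is free: no nonidentity element has a fixed point. -/
def freeAction (Γ : Subgroup (Equiv.Perm V3)) : Prop :=
  ∀ f ∈ Γ, f ≠ 1 → ∀ x : V3, f x ≠ x

lemma mdot_comm (x y : V3) : mdot x y = mdot y x := by
  simp only [mdot]; ring

lemma mdot_neg_right (x y : V3) : mdot x (-y) = -mdot x y := by
  simp only [mdot, Pi.neg_apply]; ring

lemma mdot_neg_left (x y : V3) : mdot (-x) y = -mdot x y := by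
  simp only [mdot, Pi.neg_apply]; ring

lemma mdot_smul_left (t : ℝ) (x y : V3) : mdot (t • x) y = t * mdot x y := by
  simp only [mdot, Pi.smul_apply, smul_eq_mul]; ring

lemma mdot_smul_right (t : ℝ) (x y : V3) : mdot x (t • y) = t * mdot x y := by
  simp only [mdot, Pi.smul_apply, smul_eq_mul]; ring

lemma mdot_sub_left (x y z : V3) : mdot (x - y) z = mdot x z - mdot y z := by
  simp only [mdot, Pi.sub_apply]; ring

lemma nullMinus_eq_nullPlus_neg (v : V3) : nullMinus v = nullPlus (-v) := by
  simp only [nullMinus, nullPlus, mdot_neg_left, mdot_neg_right, neg_neg, Pi.neg_apply,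
    neg_sq, neg_mul, mul_neg, sub_neg_eq_add, ← sub_eq_add_neg]

lemma sq_add_sq_eq_of_mdot_self {v : V3} (hv : mdot v v = 1) :
    v 0 ^ 2 + v 1 ^ 2 = 1 + v 2 ^ 2 := by
  simp only [mdot] at hv; linarith

/-- The scaling factor in the definition of `nullPlus`. -/
lemma exists_nullPlus_eq {v : V3} (hv : mdot v v = 1) :
    ∃ c : ℝ, 0 < c ∧
      nullPlus v = c • ![v 0 * v 2 + v 1, v 1 * v 2 - v 0, 1 + v 2 ^ 2] ∧
      nullMinus v = c • ![v 0 * v 2 - v 1, v 1 * v 2 + v 0, 1 + v 2 ^ 2] := by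
  have h := sq_add_sq_eq_of_mdot_self hv
  refine ⟨1 / (Real.sqrt 2 * (v 0 ^ 2 + v 1 ^ 2)), ?_, ?_, ?_⟩
  · rw [h]; positivity
  · simp only [nullPlus, hv, Real.sqrt_one, mul_one, h]
  · simp only [nullMinus, hv, Real.sqrt_one, mul_one, h]

lemma nullPlus_two_pos {v : V3} (hv : mdot v v = 1) : 0 < nullPlus v 2 := by
  obtain ⟨c, hc, hp, -⟩ := exists_nullPlus_eq hv
  simp only [hp, Pi.smul_apply, smul_eq_mul, Matrix.cons_val]
  positivity

lemma lcross_nullPlus {v : V3} (hv : mdot v v = 1) :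
    lcross v (nullPlus v) = nullPlus v := by
  obtain ⟨c, -, hp, -⟩ := exists_nullPlus_eq hv
  have h := sq_add_sq_eq_of_mdot_self hv
  ext i
  fin_cases i <;> simp [hp, lcross]
  · ring
  · ring
  · linear_combination c * h

lemma mdot_eq_zero_of_lcross_eq {v x : V3} (h : lcross v x = x) :
    mdot v x = 0 ∧ mdot x x = 0 := by
  have h0 := congrFun h 0
  have h1 := congrFun h 1
  have h2 := congrFun h 2
  simp only [lcross, Matrix.cons_val] at h0 h1 h2
  simp only [mdot]
  constructor
  · linear_combination -v 0 * h0 - v 1 * h1 + v 2 * h2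
  · linear_combination -x 0 * h0 - x 1 * h1 + x 2 * h2

lemma mdot_nullMinus_nullPlus_neg {v : V3} (hv : mdot v v = 1) :
    mdot (nullMinus v) (nullPlus v) < 0 := by
  obtain ⟨c, hc, hp, hm⟩ := exists_nullPlus_eq hv
  have h := sq_add_sq_eq_of_mdot_self hv
  have : mdot (nullMinus v) (nullPlus v) = -(2 * c ^ 2 * (1 + v 2 ^ 2)) := by
    simp only [hp, hm, mdot, Pi.smul_apply, smul_eq_mul, Matrix.cons_val]
    linear_combination c ^ 2 * (v 2 ^ 2 - 1) * h
  rw [this]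
  have : 0 < 2 * c ^ 2 * (1 + v 2 ^ 2) := by positivity
  linarith

/-- The Lorentzian norm in the null frame `v⁻, v⁺, v`. -/
lemma mdot_self_null_frame {v : V3} (hv : mdot v v = 1) (w : V3) :
    mdot (nullMinus v) (nullPlus v) * mdot w w =
      2 * mdot w (nullPlus v) * mdot w (nullMinus v) +
        mdot (nullMinus v) (nullPlus v) * mdot w v ^ 2 := by
  obtain ⟨c, -, hp, hm⟩ := exists_nullPlus_eq hv
  have h : v 0 ^ 2 = 1 + v 2 ^ 2 - v 1 ^ 2 := by
    linarith [sq_add_sq_eq_of_mdot_self hv]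
  simp only [hp, hm, mdot, Pi.smul_apply, smul_eq_mul, Matrix.cons_val]
  ring_nf
  have h3 : v 0 ^ 3 = (1 + v 2 ^ 2 - v 1 ^ 2) * v 0 := by rw [← h]; ring
  have h4 : v 0 ^ 4 = (1 + v 2 ^ 2 - v 1 ^ 2) ^ 2 := by rw [← h]; ring
  simp only [h, h3, h4]
  ring

/-- A vector Lorentz-orthogonal to `x`, `y` and `x ⊠ y` vanishes if `x ⊠ y` is not null. -/
lemma eq_zero_of_mdot_eq_zero {x y d : V3} (hn : mdot (lcross x y) (lcross x y) ≠ 0)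
    (hx : mdot d x = 0) (hy : mdot d y = 0) (hxy : mdot d (lcross x y) = 0) : d = 0 := by
  have key : mdot (lcross x y) (lcross x y) • d = mdot d (lcross x y) • lcross x y +
      mdot d x • lcross y (lcross x y) + mdot d y • lcross (lcross x y) x := by
    ext i
    fin_cases i <;> simp [mdot, lcross] <;> ring
  rw [hx, hy, hxy] at key
  simpa [hn] using key

lemma mdot_lcross_self (x y : V3) :
    mdot (lcross x y) (lcross x y) = mdot x y ^ 2 - mdot x x * mdot y y := by
  simp only [mdot, lcross, Matrix.cons_val]; ring

lemma mdot_lcross_rotate (x y z : V3) : mdot x (lcross y z) = mdot z (lcross x y) := by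
  simp only [mdot, lcross, Matrix.cons_val]; ring

/-- If `v`, `x` and `w`, `y` are such pairs of a spacelike and an associated null vector, then
`v + w` is in the plane spanned by `x` and `y`. -/
lemma smul_add_eq_of_lcross_eq {v w x y : V3} (hx : lcross v x = x) (hy : lcross w y = y)
    (hxy : mdot x y ≠ 0) :
    mdot x y • (v + w) = mdot v y • x + mdot w x • y := by
  obtain ⟨hvx, hxx⟩ := mdot_eq_zero_of_lcross_eq hx
  obtain ⟨hwy, hyy⟩ := mdot_eq_zero_of_lcross_eq hy
  rw [← sub_eq_zero]
  have hv : mdot v (lcross x y) = mdot x y := by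
    rw [mdot_lcross_rotate, hx, mdot_comm]
  have hw : mdot w (lcross x y) = -mdot x y := by
    rw [← hy]
    simp only [mdot, lcross, Matrix.cons_val]
    have h0 := congrFun hy 0
    have h1 := congrFun hy 1
    have h2 := congrFun hy 2
    simp only [lcross, Matrix.cons_val] at h0 h1 h2
    rw [h0, h1, h2]
    linear_combination -x 0 * h0 - x 1 * h1 + x 2 * h2
  have expand : ∀ z, mdot (mdot x y • (v + w) - (mdot v y • x + mdot w x • y)) z =
      mdot x y * (mdot v z + mdot w z) - (mdot v y * mdot x z + mdot w x * mdot y z) := by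
    intro z
    simp only [mdot, Pi.sub_apply, Pi.add_apply, Pi.smul_apply, smul_eq_mul]; ring
  refine eq_zero_of_mdot_eq_zero (x := x) (y := y) ?_ ?_ ?_ ?_
  · rw [mdot_lcross_self, hxx, zero_mul, sub_zero]; exact pow_ne_zero 2 hxy
  · rw [expand, hvx, hxx, mdot_comm y x]; ring
  · rw [expand, hwy, hyy]; ring
  · have e1 : mdot x (lcross x y) = 0 := by simp only [mdot, lcross, Matrix.cons_val]; ring
    have e2 : mdot y (lcross x y) = 0 := by simp only [mdot, lcross, Matrix.cons_val]; ring
    rw [expand, hv, hw, e1, e2]; ring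

lemma mdot_neg_of_null {x y : V3} (hx : mdot x x = 0) (hy : mdot y y = 0) (hx2 : 0 < x 2)
    (hy2 : 0 < y 2) (v : V3) (hvx : mdot v x = 0) (hvy : mdot v y ≠ 0) : mdot x y < 0 := by
  have hsq : (x 0 * y 2 - x 2 * y 0) ^ 2 + (x 1 * y 2 - x 2 * y 1) ^ 2 =
      2 * (x 2 * y 2) * -mdot x y := by
    simp only [mdot] at *
    linear_combination y 2 ^ 2 * hx + x 2 ^ 2 * hy
  have hpos : 0 < x 2 * y 2 := mul_pos hx2 hy2
  by_contra! hk
  have h0 : (x 0 * y 2 - x 2 * y 0) ^ 2 + (x 1 * y 2 - x 2 * y 1) ^ 2 ≤ 0 := by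
    rw [hsq]; nlinarith
  have ha : x 0 * y 2 - x 2 * y 0 = 0 := by
    refine pow_eq_zero_iff two_ne_zero |>.mp ?_
    nlinarith [sq_nonneg (x 0 * y 2 - x 2 * y 0), sq_nonneg (x 1 * y 2 - x 2 * y 1)]
  have hb : x 1 * y 2 - x 2 * y 1 = 0 := by
    refine pow_eq_zero_iff two_ne_zero |>.mp ?_
    nlinarith [sq_nonneg (x 0 * y 2 - x 2 * y 0), sq_nonneg (x 1 * y 2 - x 2 * y 1)]
  refine hvy ((mul_eq_zero.mp ?_).resolve_left hx2.ne')
  simp only [mdot] at *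
  linear_combination y 2 * hvx - v 0 * ha - v 1 * hb

lemma mdot_ne_zero_of_ultraparallel {u v x : V3}
    (hn : 0 < mdot (lcross u v) (lcross u v)) (hx : lcross v x = x) (hx2 : 0 < x 2) :
    mdot u x ≠ 0 := by
  intro h
  have hvx := (mdot_eq_zero_of_lcross_eq hx).1
  have : x = 0 := by
    refine eq_zero_of_mdot_eq_zero hn.ne' (by rwa [mdot_comm]) (by rwa [mdot_comm]) ?_
    rw [← mdot_lcross_rotate, hx, h]
  simp [this] at hx2

/-- The wing of a crooked plane through `x = v⁺` lies on the positive side of `v`. -/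
lemma mdot_pos_of_mem_wingSet {v x w : V3} (hv : mdot v v = 1) (hx : lcross v x = x)
    (hx2 : 0 < x 2) (hw : w ∈ wingSet x) : 0 < mdot w v := by
  obtain ⟨hww, -, t, ht, hwt⟩ := hw
  set s := Real.sqrt (mdot w w)
  have hs0 : 0 < s := Real.sqrt_pos.mpr hww
  have hss : s * s = mdot w w := Real.mul_self_sqrt hww.le
  have hu : mdot (s⁻¹ • w) (s⁻¹ • w) = 1 := by
    rw [mdot_smul_left, mdot_smul_right, ← hss]; field_simp
  have hc := lcross_nullPlus hu
  rw [hwt] at hc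
  set u := s⁻¹ • w with hudef
  have hux : lcross u x = x := by
    have : lcross u (t • x) = t • lcross u x := by
      ext i; fin_cases i <;> simp [lcross] <;> ring
    rw [this] at hc
    exact smul_right_injective _ ht.ne' hc
  have hvx := (mdot_eq_zero_of_lcross_eq hx).1
  have huv : mdot u v = 1 := by
    have a0 := congrFun hux 0
    have a1 := congrFun hux 1
    have b0 := congrFun hx 0
    have b1 := congrFun hx 1
    simp only [lcross, Matrix.cons_val] at a0 a1 b0 b1
    refine mul_left_cancel₀ hx2.ne' ?_
    simp only [mdot] at *
    linear_combination x 2 * hv + (u 2 - v 2) * hvx + v 1 * (a0 - b0) - v 0 * (a1 - b1)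
  have hwu : mdot w v = s * mdot u v := by
    rw [hudef, mdot_smul_left]; field_simp
  rw [hwu, huv, mul_one]; exact hs0

/-- Translating the vertex by `a v⁻ - b v⁺` with `a, b > 0` moves the crooked plane of `v` to one
side of the crooked plane with vertex at the origin. -/
lemma sides_of_mem_crookedPlane {v q : V3} {a b : ℝ} (hv : mdot v v = 1) (ha : 0 < a)
    (hb : 0 < b) (hq : q ∈ crookedPlane v (a • nullMinus v - b • nullPlus v)) :
    (0 ≤ mdot q v ∧ mdot q (nullPlus v) < 0) ∨ (mdot q v ≤ 0 ∧ 0 < mdot q (nullMinus v)) := by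
  have hv' : mdot (-v) (-v) = 1 := by rw [mdot_neg_left, mdot_neg_right, neg_neg, hv]
  have hP := lcross_nullPlus hv
  have hM := lcross_nullPlus hv'
  have hP2 := nullPlus_two_pos hv
  have hM2 := nullPlus_two_pos hv'
  have hk := mdot_nullMinus_nullPlus_neg hv
  have hframe := mdot_self_null_frame hv (q - (a • nullMinus v - b • nullPlus v))
  rw [← nullMinus_eq_nullPlus_neg] at hM hM2
  obtain ⟨hvP, hPP⟩ := mdot_eq_zero_of_lcross_eq hP
  obtain ⟨hvM, hMM⟩ := mdot_eq_zero_of_lcross_eq hM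
  rw [mdot_neg_left, neg_eq_zero] at hvM
  have hwv : mdot (q - (a • nullMinus v - b • nullPlus v)) v = mdot q v := by
    rw [mdot_sub_left, mdot_sub_left, mdot_smul_left, mdot_smul_left,
      mdot_comm (nullMinus v), hvM, mdot_comm (nullPlus v), hvP]
    ring
  have hwP : mdot (q - (a • nullMinus v - b • nullPlus v)) (nullPlus v) =
      mdot q (nullPlus v) - a * mdot (nullMinus v) (nullPlus v) := by
    simp only [mdot_sub_left, mdot_smul_left, hPP]; ring
  have hwM : mdot (q - (a • nullMinus v - b • nullPlus v)) (nullMinus v) =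
      mdot q (nullMinus v) + b * mdot (nullMinus v) (nullPlus v) := by
    simp only [mdot_sub_left, mdot_smul_left, hMM, mdot_comm (nullPlus v)]; ring
  have hak := mul_neg_of_pos_of_neg ha hk
  have hbk := mul_neg_of_pos_of_neg hb hk
  rcases hq with (⟨h0, hle⟩ | hw) | hw
  · by_cases hp : mdot (q - (a • nullMinus v - b • nullPlus v)) (nullPlus v) ≤ 0
    · exact Or.inl ⟨by linarith, by linarith⟩
    by_cases hm : 0 ≤ mdot (q - (a • nullMinus v - b • nullPlus v)) (nullMinus v)
    · exact Or.inr ⟨by linarith, by linarith⟩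
    rw [h0] at hframe
    have := mul_neg_of_pos_of_neg (not_le.mp hp) (not_le.mp hm)
    have := mul_nonneg_of_nonpos_of_nonpos hk.le hle
    linarith
  · have h := mdot_pos_of_mem_wingSet hv hP hP2 hw
    have h0 := hw.2.1
    exact Or.inl ⟨by linarith, by linarith⟩
  · have h := mdot_pos_of_mem_wingSet hv' hM hM2 hw
    have h0 := hw.2.1
    rw [mdot_neg_right] at h
    exact Or.inr ⟨by linarith, by linarith⟩

lemma false_of_opposite_sides {v w x y q : V3} (hx : lcross v x = x) (hy : lcross w y = y)
    (hxy : mdot x y < 0) (hqv : 0 ≤ mdot q v) (hqw : 0 ≤ mdot q w)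
    (h1 : 0 < mdot v y * mdot q x) (h2 : 0 < mdot w x * mdot q y) : False := by
  have h := congrArg (mdot q) (smul_add_eq_of_lcross_eq hx hy hxy.ne)
  have hl : mdot q (mdot x y • (v + w)) = mdot x y * (mdot q v + mdot q w) := by
    rw [mdot_smul_right]; simp only [mdot, Pi.add_apply]; ring
  have hr : mdot q (mdot v y • x + mdot w x • y) =
      mdot v y * mdot q x + mdot w x * mdot q y := by
    rw [← mdot_smul_right, ← mdot_smul_right]; simp only [mdot, Pi.add_apply]; ring
  rw [hl, hr] at h
  have := mul_nonpos_of_nonpos_of_nonneg hxy.le (add_nonneg hqv hqw)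
  linarith

/-- If `v₁`, `v₂` are consistently oriented, ultraparallel, unit
spacelike vectors and `pᵢ = aᵢvᵢ⁻ − bᵢvᵢ⁺` with `aᵢ, bᵢ > 0`, then the crooked
planes `C(v₁,p₁)` and `C(v₂,p₂)` are disjoint. -/
theorem crooked_planes_disjoint_ultraparallel_cone
    (v1 v2 : V3) (a1 b1 a2 b2 : ℝ)
    (h1 : mdot v1 v1 = 1) (h2 : mdot v2 v2 = 1)
    (hco : consistentlyOriented v1 v2)
    (hultra : 0 < mdot (lcross v1 v2) (lcross v1 v2))
    (ha1 : 0 < a1) (hb1 : 0 < b1) (ha2 : 0 < a2) (hb2 : 0 < b2) :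
    crookedPlane v1 (a1 • nullMinus v1 - b1 • nullPlus v1) ∩
      crookedPlane v2 (a2 • nullMinus v2 - b2 • nullPlus v2) = ∅ := by
  obtain ⟨-, hP2, hM2, hP1, hM1⟩ := hco
  have h1' : mdot (-v1) (-v1) = 1 := by rw [mdot_neg_left, mdot_neg_right, neg_neg, h1]
  have h2' : mdot (-v2) (-v2) = 1 := by rw [mdot_neg_left, mdot_neg_right, neg_neg, h2]
  have hlt : ∀ {u v : V3}, mdot v v = 1 → mdot u (nullPlus v) ≤ 0 →
      0 < mdot (lcross u v) (lcross u v) → mdot u (nullPlus v) < 0 := fun hv h hn =>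
    h.lt_of_ne (mdot_ne_zero_of_ultraparallel hn (lcross_nullPlus hv) (nullPlus_two_pos hv))
  have hnull : ∀ {u v : V3}, mdot u u = 1 → mdot v v = 1 → mdot u (nullPlus v) ≠ 0 →
      mdot (nullPlus u) (nullPlus v) < 0 := fun {u v} hu hv h =>
    mdot_neg_of_null (mdot_eq_zero_of_lcross_eq (lcross_nullPlus hu)).2
      (mdot_eq_zero_of_lcross_eq (lcross_nullPlus hv)).2 (nullPlus_two_pos hu)
      (nullPlus_two_pos hv) u (mdot_eq_zero_of_lcross_eq (lcross_nullPlus hu)).1 h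
  rw [nullMinus_eq_nullPlus_neg] at hM1 hM2
  rw [mdot_lcross_self] at hultra
  replace hP2 := hlt h2 hP2 (by rwa [mdot_lcross_self])
  replace hM2 := hlt h2' hM2 (by
    simpa only [mdot_lcross_self, mdot_neg_left, mdot_neg_right, neg_neg, neg_sq] using hultra)
  replace hP1 := hlt h1 hP1 (by rwa [mdot_lcross_self, mdot_comm v2 v1, mul_comm])
  replace hM1 := hlt h1' hM1 (by
    simpa only [mdot_lcross_self, mdot_neg_left, mdot_neg_right, neg_neg, neg_sq,
      mdot_comm v2 v1, mul_comm] using hultra)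
  rw [Set.eq_empty_iff_forall_notMem]
  rintro q ⟨hq1, hq2⟩
  have hs1 := sides_of_mem_crookedPlane h1 ha1 hb1 hq1
  have hs2 := sides_of_mem_crookedPlane h2 ha2 hb2 hq2
  rw [nullMinus_eq_nullPlus_neg] at hs1 hs2
  rcases hs1 with ⟨hv1, hn1⟩ | ⟨hv1, hn1⟩ <;> rcases hs2 with ⟨hv2, hn2⟩ | ⟨hv2, hn2⟩
  · exact false_of_opposite_sides (lcross_nullPlus h1) (lcross_nullPlus h2)
      (hnull h1 h2 hP2.ne) hv1 hv2 (mul_pos_of_neg_of_neg hP2 hn1)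
      (mul_pos_of_neg_of_neg hP1 hn2)
  · exact false_of_opposite_sides (lcross_nullPlus h1) (lcross_nullPlus h2')
      (hnull h1 h2' hM2.ne) hv1 (by rw [mdot_neg_right]; linarith)
      (mul_pos_of_neg_of_neg hM2 hn1)
      (mul_pos (by rw [mdot_neg_left]; linarith) hn2)
  · exact false_of_opposite_sides (lcross_nullPlus h1') (lcross_nullPlus h2)
      (hnull h1' h2 (by rw [mdot_neg_left]; exact neg_ne_zero.mpr hP2.ne))
      (by rw [mdot_neg_right]; linarith) hv2
      (mul_pos (by rw [mdot_neg_left]; linarith) hn1)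
      (mul_pos_of_neg_of_neg hM1 hn2)
  · exact false_of_opposite_sides (lcross_nullPlus h1') (lcross_nullPlus h2')
      (hnull h1' h2' (by rw [mdot_neg_left]; exact neg_ne_zero.mpr hM2.ne))
      (by rw [mdot_neg_right]; linarith) (by rw [mdot_neg_right]; linarith)
      (mul_pos (by rw [mdot_neg_left]; linarith) hn1)
      (mul_pos (by rw [mdot_neg_left]; linarith) hn2)
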